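/- Let η := (1_A/π̂) • Z, and let η₁, …, η_n : Ω → H be mutually independent random elements, each identically distributed with η. Then E[‖(1/n) Σ_{s=1}^n η_s − Δ‖²] = (1/n) · E[‖η − E[η]‖²] + ‖E[η] − Δ‖² ≤ (1/n) · E[‖η − E[η]‖²] + ε⁻² · ρ_π² · E[‖m‖²]. In particular, the mean-squared error of the Inverse Propensity Weighting (IPW) estimator of the causal map is bounded by the squared L² propensity-score error (up to the constant ε⁻² E[‖m‖²]) plus a variance term of order n⁻¹. -/

import Mathlib

open MeasureTheory ProbabilityTheory

lemma ipw_memLp_smul_of_bdd {Ω : Type*} {mΩ : MeasurableSpace Ω} {P : Measure Ω}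
    {H : Type*} [NormedAddCommGroup H] [NormedSpace ℝ H]
    {f : Ω → ℝ} (hf : AEStronglyMeasurable f P) {g : Ω → H} (hg : MemLp g 2 P) (C : ℝ)
    (hC : ∀ᵐ ω ∂P, ‖f ω‖ ≤ C) : MemLp (fun ω => f ω • g ω) 2 P := by
  refine MemLp.of_le_mul (c := C) hg (hf.smul hg.1) ?_
  filter_upwards [hC] with ω h
  rw [norm_smul]
  gcongr

lemma ipw_cauchy_schwarz {Ω : Type*} {mΩ : MeasurableSpace Ω} {P : Measure Ω}
    {f g : Ω → ℝ} (hf0 : ∀ ω, 0 ≤ f ω) (hg0 : ∀ ω, 0 ≤ g ω)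
    (hf : MemLp f 2 P) (hg : MemLp g 2 P) :
    (∫ ω, f ω * g ω ∂P) ^ 2 ≤ (∫ ω, f ω ^ 2 ∂P) * ∫ ω, g ω ^ 2 ∂P := by
  have h := integral_mul_le_Lp_mul_Lq_of_nonneg (μ := P) Real.HolderConjugate.two_two
    (Filter.Eventually.of_forall hf0) (Filter.Eventually.of_forall hg0)
    (by simpa using hf) (by simpa using hg)
  have h0 : 0 ≤ ∫ ω, f ω * g ω ∂P := integral_nonneg fun ω => mul_nonneg (hf0 ω) (hg0 ω)
  have hF : 0 ≤ ∫ ω, f ω ^ 2 ∂P := integral_nonneg fun ω => sq_nonneg _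
  have hG : 0 ≤ ∫ ω, g ω ^ 2 ∂P := integral_nonneg fun ω => sq_nonneg _
  simp only [Real.rpow_two, ← Real.sqrt_eq_rpow] at h
  calc _ ≤ (√(∫ ω, f ω ^ 2 ∂P) * √(∫ ω, g ω ^ 2 ∂P)) ^ 2 := by gcongr
    _ = _ := by rw [mul_pow, Real.sq_sqrt hF, Real.sq_sqrt hG]

lemma ipw_integrable_inner {Ω : Type*} {mΩ : MeasurableSpace Ω} {P : Measure Ω}
    {H : Type*} [NormedAddCommGroup H] [InnerProductSpace ℝ H]
    {f g : Ω → H} (hf : MemLp f 2 P) (hg : MemLp g 2 P) :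
    Integrable (fun ω => inner ℝ (f ω) (g ω)) P := by
  refine Integrable.mono' (hf.norm.integrable_mul hg.norm) (hf.1.inner hg.1) ?_
  exact Filter.Eventually.of_forall fun ω => norm_inner_le_norm _ _

lemma ipw_mse_decomp {Ω : Type*} {mΩ : MeasurableSpace Ω} {P : Measure Ω} [IsProbabilityMeasure P]
    {H : Type*} [NormedAddCommGroup H] [InnerProductSpace ℝ H] [CompleteSpace H]
    {n : ℕ} (hn : 0 < n) (X : Fin n → Ω → H) (b : H) (V : ℝ)
    (hX : ∀ s, MemLp (X s) 2 P) (hmean : ∀ s, ∫ ω, X s ω ∂P = 0)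
    (hV : ∀ s, ∫ ω, ‖X s ω‖ ^ 2 ∂P = V)
    (hcov : ∀ s t, s ≠ t → ∫ ω, inner ℝ (X s ω) (X t ω) ∂P = 0) :
    ∫ ω, ‖(n : ℝ)⁻¹ • ∑ s, X s ω + b‖ ^ 2 ∂P = (n : ℝ)⁻¹ * V + ‖b‖ ^ 2 := by
  have hS : MemLp (fun ω => ∑ s, X s ω) 2 P := memLp_finsetSum _ fun s _ => hX s
  have hSi : Integrable (fun ω => ∑ s, X s ω) P := hS.integrable one_le_two
  have hSm : ∫ ω, ∑ s, X s ω ∂P = 0 := by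
    rw [integral_finsetSum _ fun s _ => (hX s).integrable one_le_two]
    simp [hmean]
  have hSV : ∫ ω, ‖∑ s, X s ω‖ ^ 2 ∂P = n * V := by
    have : ∀ ω, ‖∑ s, X s ω‖ ^ 2 = ∑ s, ∑ t, inner ℝ (X s ω) (X t ω) := by
      intro ω
      rw [← real_inner_self_eq_norm_sq, sum_inner]
      simp_rw [inner_sum]
    simp_rw [this]
    rw [integral_finsetSum _ fun s _ => integrable_finsetSum _ fun t _ =>
      ipw_integrable_inner (hX s) (hX t)]
    have h2 : ∀ s, ∫ ω, ∑ t, inner ℝ (X s ω) (X t ω) ∂P = V := by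
      intro s
      rw [integral_finsetSum _ fun t _ => ipw_integrable_inner (hX s) (hX t),
        Finset.sum_eq_single s (fun t _ ht => hcov s t ht.symm) (by simp)]
      simp_rw [real_inner_self_eq_norm_sq]
      exact hV s
    simp [h2]
  have hexp : ∀ ω, ‖(n : ℝ)⁻¹ • ∑ s, X s ω + b‖ ^ 2
      = (n : ℝ)⁻¹ ^ 2 * ‖∑ s, X s ω‖ ^ 2 + (2 * (n : ℝ)⁻¹ * inner ℝ b (∑ s, X s ω) + ‖b‖ ^ 2) := by
    intro ω
    rw [norm_add_sq_real, norm_smul, mul_pow, real_inner_smul_left, real_inner_comm]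
    simp only [norm_inv, Real.norm_natCast]
    ring
  simp_rw [hexp]
  have hi1 : Integrable (fun ω => (n : ℝ)⁻¹ ^ 2 * ‖∑ s, X s ω‖ ^ 2) P :=
    (hS.integrable_norm_pow (by simp)).const_mul _
  have hi2 : Integrable (fun ω => 2 * (n : ℝ)⁻¹ * inner ℝ b (∑ s, X s ω)) P :=
    (hSi.const_inner b).const_mul _
  have hi3 : Integrable (fun ω => 2 * (n : ℝ)⁻¹ * inner ℝ b (∑ s, X s ω) + ‖b‖ ^ 2) P :=
    hi2.add (integrable_const _)
  rw [integral_add hi1 hi3, integral_add hi2 (integrable_const _),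
    integral_const_mul, integral_const_mul, integral_inner hSi, hSm, hSV]
  have : (n : ℝ) ≠ 0 := by positivity
  simp
  field_simp

lemma ipw_identDistrib {Ω : Type*} {mΩ : MeasurableSpace Ω} {P : Measure Ω}
    {H : Type*} [NormedAddCommGroup H] [InnerProductSpace ℝ H]
    [SecondCountableTopology H] [MeasurableSpace H] [BorelSpace H]
    {X Y : Ω → H} (h : IdentDistrib X Y P P) (hY : MemLp Y 2 P) :
    MemLp X 2 P ∧ ∫ ω, X ω ∂P = ∫ ω, Y ω ∂P ∧
      ∀ c : H, ∫ ω, ‖X ω - c‖ ^ 2 ∂P = ∫ ω, ‖Y ω - c‖ ^ 2 ∂P :=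
  ⟨h.memLp_iff.2 hY, h.integral_eq, fun c =>
    (h.comp (u := fun x => ‖x - c‖ ^ 2) (by fun_prop)).integral_eq⟩

/-- **Finite-sample MSE bound for the Inverse Propensity Weighting (IPW) estimator
(Appendix C).** With `η := (1_A/π̂) • Z` and `η₁, …, η_n` i.i.d. copies of `η`,
`E[‖(1/n) Σ_s η_s − Δ‖²] = (1/n) E[‖η − E[η]‖²] + ‖E[η] − Δ‖²
  ≤ (1/n) E[‖η − E[η]‖²] + ε⁻² ρ_π² E[‖m‖²]`,
where `Δ = E[m]` is the causal map and `ρ_π = (E[(π̂ − π)²])^{1/2}`. -/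
theorem ipw_estimator_mse_bound
    {Ω : Type*} [mΩ : MeasurableSpace Ω] (P : Measure Ω) [IsProbabilityMeasure P]
    {H : Type*} [NormedAddCommGroup H] [InnerProductSpace ℝ H] [CompleteSpace H]
    [SecondCountableTopology H] [MeasurableSpace H] [BorelSpace H]
    (𝔪 : MeasurableSpace Ω) (h𝔪 : 𝔪 ≤ mΩ)
    (A : Set Ω) (hA : MeasurableSet[mΩ] A)
    (Z : Ω → H) (hZmeas : StronglyMeasurable[mΩ] Z) (hZ : MemLp Z 2 P)
    (π : Ω → ℝ) (hπmeas : Measurable[𝔪] π)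
    (hπver : π =ᵐ[P] P[A.indicator (fun _ => (1 : ℝ)) | 𝔪])
    (ε : ℝ) (hε : ε ∈ Set.Ioo (0 : ℝ) (1/2))
    (hπbdd : ∀ᵐ ω ∂P, π ω ∈ Set.Icc ε (1 - ε))
    (m : Ω → H) (hmmeas : StronglyMeasurable[𝔪] m)
    (hmver : m =ᵐ[P] fun ω => (π ω)⁻¹ • (P[A.indicator Z | 𝔪]) ω)
    (hm : MemLp m 2 P)
    (πhat : Ω → ℝ) (hπhatmeas : Measurable[𝔪] πhat)
    (hπhatbdd : ∀ᵐ ω ∂P, πhat ω ∈ Set.Icc ε (1 - ε))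
    (η : Ω → H)
    (hηdef : η = fun ω => (A.indicator (fun _ => (1 : ℝ)) ω / πhat ω) • Z ω)
    {n : ℕ} (hn : 0 < n) (ηs : Fin n → Ω → H)
    (hindep : iIndepFun (_mΩ := mΩ) (m := fun _ => (inferInstance : MeasurableSpace H)) ηs P)
    (hident : ∀ s, @IdentDistrib Ω Ω H mΩ mΩ _ (ηs s) η P P) :
    (∫ ω, ‖(n : ℝ)⁻¹ • ∑ s, ηs s ω - ∫ ω', m ω' ∂P‖ ^ 2 ∂P
        = (n : ℝ)⁻¹ * (∫ ω, ‖η ω - ∫ ω', η ω' ∂P‖ ^ 2 ∂P)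
          + ‖(∫ ω, η ω ∂P) - ∫ ω', m ω' ∂P‖ ^ 2) ∧
    (∫ ω, ‖(n : ℝ)⁻¹ • ∑ s, ηs s ω - ∫ ω', m ω' ∂P‖ ^ 2 ∂P
        ≤ (n : ℝ)⁻¹ * (∫ ω, ‖η ω - ∫ ω', η ω' ∂P‖ ^ 2 ∂P)
          + ε⁻¹ ^ 2 * (∫ ω, (πhat ω - π ω) ^ 2 ∂P) * ∫ ω, ‖m ω‖ ^ 2 ∂P) := by
  obtain ⟨hε0, -⟩ := hε
  have hhat : ∀ᵐ ω ∂P, 0 < πhat ω ∧ |(πhat ω)⁻¹| ≤ ε⁻¹ := by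
    filter_upwards [hπhatbdd] with ω h
    have h0 : 0 < πhat ω := lt_of_lt_of_le hε0 h.1
    refine ⟨h0, ?_⟩
    rw [abs_of_pos (inv_pos.2 h0)]
    exact inv_anti₀ hε0 h.1
  have hinvm : StronglyMeasurable[𝔪] (fun ω => (πhat ω)⁻¹) := hπhatmeas.inv.stronglyMeasurable
  have hinv : AEStronglyMeasurable[mΩ] (fun ω => (πhat ω)⁻¹) P :=
    (hinvm.mono h𝔪).aestronglyMeasurable
  have hAZ : MemLp (A.indicator Z) 2 P := hZ.indicator hA
  have hηeq : η = fun ω => (πhat ω)⁻¹ • A.indicator Z ω := by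
    rw [hηdef]
    funext ω
    by_cases h : ω ∈ A <;> simp [h]
  have hη : MemLp η 2 P := by
    rw [hηeq]
    exact ipw_memLp_smul_of_bdd hinv hAZ ε⁻¹ (hhat.mono fun ω h => h.2)
  have hηi : Integrable η P := hη.integrable one_le_two
  have hAZi : Integrable (A.indicator Z) P := hAZ.integrable one_le_two
  have hmi : Integrable m P := hm.integrable one_le_two
  have hEη : ∫ ω, η ω ∂P = ∫ ω, (π ω / πhat ω) • m ω ∂P := by
    have hpull : P[η | 𝔪] =ᵐ[P] (fun ω => (πhat ω)⁻¹) • P[A.indicator Z | 𝔪] := by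
      have := condExp_smul_of_aestronglyMeasurable_left (μ := P) (m := 𝔪)
        (f := fun ω => (πhat ω)⁻¹) (g := A.indicator Z)
        hinvm.aestronglyMeasurable (by rw [hηeq] at hηi; exact hηi) hAZi
      rw [hηeq]
      exact this
    rw [← integral_condExp h𝔪]
    refine integral_congr_ae ?_
    filter_upwards [hpull, hmver, hπbdd] with ω h1 h2 h3
    have h0 : π ω ≠ 0 := (lt_of_lt_of_le hε0 h3.1).ne'
    rw [h1, h2, smul_smul]
    simp only [Pi.smul_apply']
    congr 1
    field_simp
  have hdiffm : AEStronglyMeasurable[mΩ] (fun ω => πhat ω - π ω) P :=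
    ((hπhatmeas.sub hπmeas).mono h𝔪 le_rfl).aestronglyMeasurable
  have hdiffbd : ∀ᵐ ω ∂P, ‖πhat ω - π ω‖ ≤ 1 := by
    filter_upwards [hπhatbdd, hπbdd] with ω h1 h2
    rw [Real.norm_eq_abs, abs_le]
    constructor <;> linarith [h1.1, h1.2, h2.1, h2.2]
  have hdiff : MemLp (fun ω => πhat ω - π ω) 2 P := MemLp.of_bound hdiffm 1 hdiffbd
  have hrat : Integrable (fun ω => (π ω / πhat ω) • m ω) P := by
    have hm1 : AEStronglyMeasurable[mΩ] (fun ω => π ω / πhat ω) P :=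
      ((hπmeas.div hπhatmeas).mono h𝔪 le_rfl).aestronglyMeasurable
    refine (ipw_memLp_smul_of_bdd hm1 hm ε⁻¹ ?_).integrable one_le_two
    filter_upwards [hhat, hπbdd] with ω h1 h2
    rw [div_eq_mul_inv, norm_mul, Real.norm_eq_abs, Real.norm_eq_abs]
    have : |π ω| ≤ 1 := by
      rw [abs_le]
      constructor <;> linarith [h2.1, h2.2]
    calc |π ω| * |(πhat ω)⁻¹| ≤ 1 * ε⁻¹ := by
          gcongr
          exact h1.2
      _ = ε⁻¹ := one_mul _
  have hbias : ‖(∫ ω, η ω ∂P) - ∫ ω', m ω' ∂P‖ ^ 2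
      ≤ ε⁻¹ ^ 2 * (∫ ω, (πhat ω - π ω) ^ 2 ∂P) * ∫ ω, ‖m ω‖ ^ 2 ∂P := by
    have hle : ‖(∫ ω, η ω ∂P) - ∫ ω', m ω' ∂P‖ ≤ ε⁻¹ * ∫ ω, ‖πhat ω - π ω‖ * ‖m ω‖ ∂P := by
      rw [hEη, ← integral_sub hrat hmi, ← integral_const_mul]
      refine norm_integral_le_of_norm_le ((hdiff.norm.integrable_mul hm.norm).const_mul _) ?_
      filter_upwards [hhat] with ω h1
      have : (π ω / πhat ω) • m ω - m ω = ((πhat ω)⁻¹ * (π ω - πhat ω)) • m ω := by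
        have h0 := h1.1.ne'
        nth_rewrite 2 [← one_smul ℝ (m ω)]
        rw [← sub_smul]
        congr 1
        field_simp
      rw [this, norm_smul, norm_mul, norm_sub_rev (π ω), mul_assoc]
      gcongr
      exact h1.2
    have hcs := ipw_cauchy_schwarz (P := P) (f := fun ω => ‖πhat ω - π ω‖) (g := fun ω => ‖m ω‖)
      (fun _ => norm_nonneg _) (fun _ => norm_nonneg _) hdiff.norm hm.norm
    simp only [Real.norm_eq_abs, sq_abs] at hcs
    calc _ ≤ (ε⁻¹ * ∫ ω, ‖πhat ω - π ω‖ * ‖m ω‖ ∂P) ^ 2 := by gcongr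
      _ ≤ _ := by
        rw [mul_pow, mul_assoc]
        gcongr
        exact hcs
  have heq : ∫ ω, ‖(n : ℝ)⁻¹ • ∑ s, ηs s ω - ∫ ω', m ω' ∂P‖ ^ 2 ∂P
        = (n : ℝ)⁻¹ * (∫ ω, ‖η ω - ∫ ω', η ω' ∂P‖ ^ 2 ∂P)
          + ‖(∫ ω, η ω ∂P) - ∫ ω', m ω' ∂P‖ ^ 2 := by
    have hs2 : ∀ s, MemLp (ηs s) 2 P := fun s => (ipw_identDistrib (hident s) hη).1
    have hs1 : ∀ s, Integrable (ηs s) P := fun s => (hs2 s).integrable one_le_two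
    have hsE : ∀ s, ∫ ω, ηs s ω ∂P = ∫ ω, η ω ∂P := fun s =>
      (ipw_identDistrib (hident s) hη).2.1
    generalize hcdef : (∫ ω, η ω ∂P) = c at *
    have hX2 : ∀ s, MemLp (fun ω => ηs s ω - c) 2 P := fun s => (hs2 s).sub (memLp_const c)
    have hX0 : ∀ s, ∫ ω, (ηs s ω - c) ∂P = 0 := by
      intro s
      rw [integral_sub (hs1 s) (integrable_const c), hsE s]
      simp
    rw [← ipw_mse_decomp hn (fun s ω => ηs s ω - c) (c - ∫ ω', m ω' ∂P)
      (∫ ω, ‖η ω - c‖ ^ 2 ∂P) hX2 hX0 ?_ ?_]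
    · refine integral_congr_ae (Filter.Eventually.of_forall fun ω => ?_)
      have hn0 : (n : ℝ) ≠ 0 := by positivity
      have : (n : ℝ)⁻¹ • ∑ s, (ηs s ω - c) = (n : ℝ)⁻¹ • ∑ s, ηs s ω - c := by
        rw [Finset.sum_sub_distrib, smul_sub]
        simp [← Nat.cast_smul_eq_nsmul ℝ, smul_smul, hn0]
      simp only [this, sub_add_sub_cancel]
    · intro s
      exact (ipw_identDistrib (hident s) hη).2.2 c
    · intro s t hst
      have hi : IndepFun (fun ω => ηs s ω - c) (fun ω => ηs t ω - c) P :=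
        (hindep.indepFun hst).comp (φ := fun x => x - c) (ψ := fun x => x - c)
          (by fun_prop) (by fun_prop)
      have := hi.integral_bilin ((hX2 s).integrable one_le_two) ((hX2 t).integrable one_le_two)
        (innerSL ℝ)
      simp only [hX0, map_zero] at this
      exact this
  exact ⟨heq, heq.le.trans (by gcongr)⟩
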